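/- arXiv:math/0012258 — 3 statements merged into one kernel-verified Lean document; each statement's English description precedes it below -/
import Mathlib

section
/- Let H be the Heawood graph and let C be the spanning cycle of H through the vertices 0, 1, 2, ..., 13 of ZMod 14 in order. Then x(C;H) = 2: there are exactly two simple graphs X on ZMod 14 with C ≤ X and X isomorphic to H. -/
/-- `σ` is an automorphism of the simple graph `G`. -/
def IsAut {V : Type*} (G : SimpleGraph V) (σ : Equiv.Perm V) : Prop :=
  ∀ u v, G.Adj (σ u) (σ v) ↔ G.Adj u v

/-- `|A(G)|`, the number of automorphisms of `G`. -/
noncomputable def autCard {V : Type*} (G : SimpleGraph V) : ℕ :=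
  Nat.card {σ : Equiv.Perm V // IsAut G σ}

/-- `|A(U) ∩ A(G)|`, the number of common automorphisms of `U` and `G`. -/
noncomputable def autCapCard {V : Type*} (U G : SimpleGraph V) : ℕ :=
  Nat.card {σ : Equiv.Perm V // IsAut U σ ∧ IsAut G σ}

/-- `s(U;G)`: the number of spanning subgraphs of `G` isomorphic to `U`. -/
noncomputable def sCard {V : Type*} (U G : SimpleGraph V) : ℕ :=
  Nat.card {U' : SimpleGraph V // U' ≤ G ∧ Nonempty (U' ≃g U)}

/-- `x(U;G)`: the number of graphs `X` on `V` with `U ≤ X` and `X` isomorphic to `G`. -/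
noncomputable def xCard {V : Type*} (U G : SimpleGraph V) : ℕ :=
  Nat.card {X : SimpleGraph V // U ≤ X ∧ Nonempty (X ≃g G)}

/-- `s₀(U;G)`: the number of spanning subgraphs of `G` that are `G`-similar to `U`,
i.e. images of `U` under an automorphism of `G`. -/
noncomputable def s0Card {V : Type*} (U G : SimpleGraph V) : ℕ :=
  Nat.card {U' : SimpleGraph V //
    U' ≤ G ∧ ∃ σ : Equiv.Perm V, IsAut G σ ∧ U.map σ.toEmbedding = U'}

/-- `U` is a fixing subgraph of `G`: it is a spanning subgraph and
`s(U;G) = |A(G)| / |A(U) ∩ A(G)|`. -/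
noncomputable def IsFixing {V : Type*} (U G : SimpleGraph V) : Prop :=
  U ≤ G ∧ sCard U G = autCard G / autCapCard U G

/-- `U` is a strong fixing subgraph of `G`: a fixing subgraph all of whose
automorphisms are automorphisms of `G`. -/
noncomputable def IsStrongFixing {V : Type*} (U G : SimpleGraph V) : Prop :=
  IsFixing U G ∧ ∀ σ : Equiv.Perm V, IsAut U σ → IsAut G σ

/-- `C` is a hamiltonian cycle of `G`: a connected 2-regular spanning subgraph. -/
def IsHamCycle {V : Type*} (G C : SimpleGraph V) : Prop :=
  C ≤ G ∧ C.Connected ∧ ∀ v, Nat.card {w // C.Adj v w} = 2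

/-- `G ∈ F(HAM)`: `G` is hamiltonian and every hamiltonian cycle of `G` is a
fixing subgraph of `G`. -/
noncomputable def InFHAM {V : Type*} (G : SimpleGraph V) : Prop :=
  (∃ C, IsHamCycle G C) ∧ ∀ C, IsHamCycle G C → IsFixing C G

/-- `G ∈ F*(HAM)`: `G` is hamiltonian and every hamiltonian cycle of `G` is a
strong fixing subgraph of `G`. -/
noncomputable def InFstarHAM {V : Type*} (G : SimpleGraph V) : Prop :=
  (∃ C, IsHamCycle G C) ∧ ∀ C, IsHamCycle G C → IsStrongFixing C G

/-- The generalized Petersen graph `G(n,k)`, with outer vertices `Sum.inl i = aᵢ`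
and inner vertices `Sum.inr i = bᵢ`, edges `aᵢaᵢ₊₁`, `aᵢbᵢ`, `bᵢbᵢ₊ₖ`. -/
def genPetersen (n k : ℕ) : SimpleGraph (ZMod n ⊕ ZMod n) :=
  SimpleGraph.fromRel fun v w =>
    match v, w with
    | Sum.inl i, Sum.inl j => j = i + 1
    | Sum.inl i, Sum.inr j => j = i
    | Sum.inr i, Sum.inr j => j = i + (k : ZMod n)
    | _, _ => False

/-- The Heawood graph on `ZMod 14`: `i ~ i+1` for all `i`, and `i ~ i+5` for even `i`
(LCF notation `[5,-5]⁷`). -/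
def heawood : SimpleGraph (ZMod 14) :=
  SimpleGraph.fromRel fun i j => j = i + 1 ∨ (Even i.val ∧ j = i + 5)

/-- The spanning cycle of the Heawood graph through `0, 1, …, 13` in order. -/
def heawoodCycle : SimpleGraph (ZMod 14) :=
  SimpleGraph.fromRel fun i j => j = i + 1

instance heawoodDec : DecidableRel heawood.Adj := fun a b =>
  decidable_of_iff (a ≠ b ∧ ((b = a + 1 ∨ (Even a.val ∧ b = a + 5)) ∨
    (a = b + 1 ∨ (Even b.val ∧ a = b + 5)))) Iff.rfl

/-- The other extension. -/
def heawood2 : SimpleGraph (ZMod 14) :=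
  SimpleGraph.fromRel fun i j => j = i + 1 ∨ (¬ Even i.val ∧ j = i + 5)

instance heawood2Dec : DecidableRel heawood2.Adj := fun a b =>
  decidable_of_iff (a ≠ b ∧ ((b = a + 1 ∨ (¬ Even a.val ∧ b = a + 5)) ∨
    (a = b + 1 ∨ (¬ Even b.val ∧ a = b + 5)))) Iff.rfl

instance cycleDec : DecidableRel heawoodCycle.Adj := fun a b =>
  decidable_of_iff (a ≠ b ∧ (b = a + 1 ∨ a = b + 1)) Iff.rfl

lemma z14 : (14 : ZMod 14) = 0 := rfl

lemma hw_third : ∀ v a : ZMod 14, heawood.Adj v a → ∀ b, heawood.Adj v b → a ≠ b →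
    ∃ c, c ≠ a ∧ c ≠ b ∧ ∀ w, heawood.Adj v w ↔ (w = a ∨ w = b ∨ w = c) := by
  decide +kernel

set_option synthInstance.maxHeartbeats 400000 in
set_option synthInstance.maxSize 4000 in
lemma hw_four : ∀ a c : ZMod 14, heawood.Adj a c → ∀ b, heawood.Adj c b →
    ∀ d, heawood.Adj a d ∧ heawood.Adj d b → a = b ∨ c = d := by
  decide +kernel

lemma hw_bip : ∀ a b : ZMod 14, heawood.Adj a b → (Even a.val ↔ ¬ Even b.val) := by
  decide +kernel

lemma hw_iso : ∀ a b : ZMod 14, heawood.Adj (a + 1) (b + 1) ↔ heawood2.Adj a b := by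
  decide +kernel

/-- Properties of the chord map. -/
structure Good (m : ZMod 14 → ZMod 14) : Prop where
  inv : ∀ i, m (m i) = i
  d : ∀ i, m i = i + 5 ∨ m i = i + 7 ∨ m i = i + 9
  up : ∀ i, m (i + 1) ≠ m i + 1
  dn : ∀ i, m (i + 1) ≠ m i - 1

lemma Good.shift {m : ZMod 14 → ZMod 14} (h : Good m) (k : ZMod 14) :
    Good (fun x => m (x + k) - k) where
  inv i := by simp [h.inv]
  d i := by
    rcases h.d (i + k) with e | e | e <;> rw [e]
    · left; ring
    · right; left; ring
    · right; right; ring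
  up i := by
    have := h.up (i + k)
    intro e; apply this
    rw [show i + k + 1 = i + 1 + k by ring]
    linear_combination e
  dn i := by
    have := h.dn (i + k)
    intro e; apply this
    rw [show i + k + 1 = i + 1 + k by ring]
    linear_combination e

lemma Good.not7_zero {m : ZMod 14 → ZMod 14} (h : Good m) : m 0 ≠ 7 := by
  intro h0
  have h7 : m 7 = 0 := by rw [← h0, h.inv]
  have h1 : m 1 = 10 := by
    rcases h.d 1 with e | e | e
    · exact absurd e (by have := h.dn 0; rw [h0] at this; exact this)
    · exact absurd e (by have := h.up 0; rw [h0] at this; exact this)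
    · exact e
  have h10 : m 10 = 1 := by rw [← h1, h.inv]
  have h13 : m 13 = 4 := by
    rcases h.d 13 with e | e | e
    · exact e
    · have := h.up 13
      rw [e] at this
      exact absurd h0 this
    · have := h.dn 13
      rw [e] at this
      exact absurd h0 this
  have h4 : m 4 = 13 := by rw [← h13, h.inv]
  have h8 : m 8 = 3 := by
    rcases h.d 8 with e | e | e
    · have := h.inv 8
      rw [e, show (8 + 5 : ZMod 14) = 13 from rfl, h13] at this
      exact absurd this (by decide)
    · have := h.inv 8
      rw [e, show (8 + 7 : ZMod 14) = 1 from rfl, h1] at this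
      exact absurd this (by decide)
    · exact e
  have h6 : m 6 = 11 := by
    rcases h.d 6 with e | e | e
    · exact e
    · have := h.inv 6
      rw [e, show (6 + 7 : ZMod 14) = 13 from rfl, h13] at this
      exact absurd this (by decide)
    · have := h.inv 6
      rw [e, show (6 + 9 : ZMod 14) = 1 from rfl, h1] at this
      exact absurd this (by decide)
  have h11 : m 11 = 6 := by rw [← h6, h.inv]
  have h2 : m 2 = 9 := by
    rcases h.d 2 with e | e | e
    · have := h.inv 2
      rw [e, show (2 + 5 : ZMod 14) = 7 from rfl, h7] at this
      exact absurd this (by decide)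
    · exact e
    · have := h.inv 2
      rw [e, show (2 + 9 : ZMod 14) = 11 from rfl, h11] at this
      exact absurd this (by decide)
  have := h.dn 1
  rw [h1] at this
  exact this h2

lemma Good.d' {m : ZMod 14 → ZMod 14} (h : Good m) (i : ZMod 14) :
    m i = i + 5 ∨ m i = i + 9 := by
  rcases h.d i with e | e | e
  · exact Or.inl e
  · have := (h.shift i).not7_zero
    simp [e] at this
  · exact Or.inr e

lemma Good.step {m : ZMod 14 → ZMod 14} (h : Good m) (i : ZMod 14) (hi : m i = i + 5) :
    m (i + 10) = i + 10 + 5 := by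
  rcases h.d' (i + 10) with e | e
  · exact e
  · have h1 := h.inv i
    have h2 := h.inv (i + 10)
    rw [e, show i + 10 + 9 = i + 5 by linear_combination z14,
      ← hi, h.inv] at h2
    exact absurd (left_eq_add.1 h2) (by decide)

lemma Good.five {m : ZMod 14 → ZMod 14} (h : Good m) (i : ZMod 14) (hi : m i = i + 5) :
    m (i + 5) = i + 5 + 9 := by
  rw [← hi, h.inv, hi]
  linear_combination -z14

lemma Good.all {m : ZMod 14 → ZMod 14} (h : Good m) (k : ZMod 14) (hk : m k = k + 5) (n : ℕ) :
    m (k + 10 * n) = k + 10 * n + 5 ∧ m (k + 10 * n + 5) = k + 10 * n + 5 + 9 := by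
  have : m (k + 10 * n) = k + 10 * n + 5 := by
    induction n with
    | zero => simpa using hk
    | succ n ih =>
      have := h.step _ ih
      push_cast
      rw [show k + 10 * ((n : ZMod 14) + 1) = k + 10 * n + 10 by ring]
      exact this
  exact ⟨this, h.five _ this⟩

lemma evod : ∀ i : ZMod 14, (Even i.val → ∃ n : Fin 7, i = 0 + 10 * ((n : ℕ) : ZMod 14)) ∧
    (¬ Even i.val → ∃ n : Fin 7, i = 0 + 10 * ((n : ℕ) : ZMod 14) + 5) := by
  decide +kernel

lemma evod1 : ∀ i : ZMod 14, (¬ Even i.val → ∃ n : Fin 7, i = 5 + 10 * ((n : ℕ) : ZMod 14)) ∧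
    (Even i.val → ∃ n : Fin 7, i = 5 + 10 * ((n : ℕ) : ZMod 14) + 5) := by
  decide +kernel

lemma Good.cases {m : ZMod 14 → ZMod 14} (h : Good m) :
    (∀ i, m i = if Even i.val then i + 5 else i + 9) ∨
    (∀ i, m i = if Even i.val then i + 9 else i + 5) := by
  rcases h.d' 0 with e | e
  · left
    intro i
    split_ifs with hi
    · obtain ⟨n, rfl⟩ := (evod i).1 hi
      exact (h.all 0 e n).1
    · obtain ⟨n, rfl⟩ := (evod i).2 hi
      exact (h.all 0 e n).2
  · right
    have e5 : m 5 = 5 + 5 := by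
      rcases h.d' 5 with e' | e'
      · exact e'
      · have := h.inv 5
        rw [e', show (5 + 9 : ZMod 14) = 0 from rfl, e] at this
        exact absurd this (by decide)
    intro i
    split_ifs with hi
    · obtain ⟨n, rfl⟩ := (evod1 i).2 hi
      exact (h.all 5 e5 n).2
    · obtain ⟨n, rfl⟩ := (evod1 i).1 hi
      exact (h.all 5 e5 n).1

lemma hw_adj : ∀ i j : ZMod 14, heawood.Adj i j ↔
    (j = i + 1 ∨ j = i - 1 ∨ j = if Even i.val then i + 5 else i + 9) := by
  decide +kernel

lemma hw2_adj : ∀ i j : ZMod 14, heawood2.Adj i j ↔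
    (j = i + 1 ∨ j = i - 1 ∨ j = if Even i.val then i + 9 else i + 5) := by
  decide +kernel

lemma cyc_adj : ∀ i : ZMod 14, heawoodCycle.Adj i (i + 1) ∧ heawoodCycle.Adj i (i - 1) := by
  decide +kernel

lemma ne_pm : ∀ i : ZMod 14, i + 1 ≠ i - 1 ∧ i + 1 ≠ i ∧ i + 2 ≠ i := by decide +kernel

lemma ext_cases (X : SimpleGraph (ZMod 14)) (hC : heawoodCycle ≤ X) (f : X ≃g heawood) :
    X = heawood ∨ X = heawood2 := by
  have a1 : ∀ i, X.Adj i (i + 1) := fun i => hC (cyc_adj i).1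
  have a2 : ∀ i, X.Adj i (i - 1) := fun i => hC (cyc_adj i).2
  have four : ∀ a b c d, X.Adj a c → X.Adj c b → X.Adj a d → X.Adj d b → a = b ∨ c = d := by
    intro a b c d h1 h2 h3 h4
    rcases hw_four (f a) (f c) (f.map_adj_iff.2 h1) (f b) (f.map_adj_iff.2 h2) (f d)
      ⟨f.map_adj_iff.2 h3, f.map_adj_iff.2 h4⟩ with e | e
    · exact Or.inl (f.injective e)
    · exact Or.inr (f.injective e)
  have third : ∀ i, ∃ c, c ≠ i + 1 ∧ c ≠ i - 1 ∧
      ∀ w, X.Adj i w ↔ (w = i + 1 ∨ w = i - 1 ∨ w = c) := by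
    intro i
    obtain ⟨c, h1, h2, h3⟩ := hw_third (f i) (f (i + 1)) (f.map_adj_iff.2 (a1 i)) (f (i - 1))
      (f.map_adj_iff.2 (a2 i)) (fun e => (ne_pm i).1 (f.injective e))
    obtain ⟨c, rfl⟩ := f.surjective c
    refine ⟨c, fun e => h1 (by rw [e]), fun e => h2 (by rw [e]), fun w => ?_⟩
    rw [← f.map_adj_iff, h3]
    simp only [f.injective.eq_iff]
  choose m m1 m2 hm using third
  have am : ∀ i, X.Adj i (m i) := fun i => (hm i _).2 (by simp)
  have bip : ∀ i j, X.Adj i j → (Even (f i).val ↔ ¬ Even (f j).val) := fun i j h =>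
    hw_bip _ _ (f.map_adj_iff.2 h)
  have par2 : ∀ i, (Even (f (i + 2)).val ↔ Even (f i).val) := by
    intro i
    have h1 := bip _ _ (a1 i)
    have h2 := bip _ _ (a1 (i + 1))
    rw [show i + 1 + 1 = i + 2 by ring] at h2
    tauto
  have parn : ∀ (n : ℕ) i, (Even (f (i + 2 * n)).val ↔ Even (f i).val) := by
    intro n i
    induction n with
    | zero => simp
    | succ n ih =>
      rw [← ih, ← par2 (i + 2 * n)]
      push_cast
      rw [show i + 2 * ((n : ZMod 14) + 1) = i + 2 * n + 2 by ring]
  have notev : ∀ (n : ℕ) i, m i ≠ i + 2 * n := by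
    intro n i e
    have h1 := bip _ _ (am i)
    rw [e] at h1
    have := parn n i
    tauto
  have minv : ∀ i, m (m i) = i := by
    intro i
    have h := (hm (m i) i).1 (am i).symm
    rcases h with h | h | h
    · exact absurd (by linear_combination -h) (m2 i)
    · exact absurd (by linear_combination -h) (m1 i)
    · exact h.symm
  have n3 : ∀ i, m i ≠ i + 3 := by
    intro i e
    have h := am i
    rw [e] at h
    have x1 := a1 (i + 1)
    have x2 := a1 (i + 2)
    rw [show i + 1 + 1 = i + 2 by ring] at x1
    rw [show i + 2 + 1 = i + 3 by ring] at x2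
    rcases four i (i + 2) (i + 1) (i + 3) (a1 i) x1 h x2.symm with e | e
    · exact (ne_pm i).2.2 e.symm
    · exact absurd (add_left_cancel e) (by decide)
  have n11 : ∀ i, m i ≠ i + 11 := by
    intro i e
    apply n3 (m i)
    rw [minv, e]
    linear_combination -z14
  have good : Good m := by
    refine ⟨minv, ?_, ?_, ?_⟩
    · intro i
      obtain ⟨d, hd⟩ : ∃ d, m i = i + d := ⟨m i - i, by ring⟩
      have key : ∀ d : ZMod 14, d = 1 ∨ d = -1 ∨ d = 3 ∨ d = 11 ∨ d = 5 ∨ d = 7 ∨ d = 9 ∨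
          ∃ n : Fin 7, d = 2 * ((n : ℕ) : ZMod 14) := by decide +kernel
      rcases key d with rfl | rfl | rfl | rfl | rfl | rfl | rfl | ⟨n, rfl⟩
      · exact absurd hd (m1 i)
      · exact absurd (by rw [hd]; ring) (m2 i)
      · exact absurd hd (n3 i)
      · exact absurd hd (n11 i)
      · exact Or.inl hd
      · exact Or.inr (Or.inl hd)
      · exact Or.inr (Or.inr hd)
      · exact absurd hd (notev n i)
    · intro i e
      have h := am (i + 1)
      rw [e] at h
      rcases four i (m i + 1) (i + 1) (m i) (a1 i) h (am i) (a1 _) with e' | e'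
      · exact m2 i (by linear_combination -e')
      · exact m1 i e'.symm
    · intro i e
      have h := am (i + 1)
      rw [e] at h
      rcases four i (m i - 1) (i + 1) (m i) (a1 i) h (am i) (a2 _) with e' | e'
      · exact m1 i (by linear_combination -e')
      · exact m1 i e'.symm
  rcases good.cases with h | h
  · left
    ext i j
    rw [hm, hw_adj, h]
  · right
    ext i j
    rw [hm, hw2_adj, h]

lemma cyc_le : heawoodCycle ≤ heawood := by
  have : ∀ a b, heawoodCycle.Adj a b → heawood.Adj a b := by decide +kernel
  exact fun {a b} h => this a b h

lemma cyc_le2 : heawoodCycle ≤ heawood2 := by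
  have : ∀ a b, heawoodCycle.Adj a b → heawood2.Adj a b := by decide +kernel
  exact fun {a b} h => this a b h

lemma hw_ne : heawood ≠ heawood2 := by
  intro h
  have h1 : heawood.Adj 0 5 := by decide +kernel
  have h2 : ¬ heawood2.Adj 0 5 := by decide +kernel
  exact h2 (h ▸ h1)

/-- There are exactly two extensions of the standard hamiltonian cycle of the
Heawood graph to a graph isomorphic to the Heawood graph: `x(C;H) = 2`. -/
theorem xCard_heawoodCycle : xCard heawoodCycle heawood = 2 := by
  have hs : {X : SimpleGraph (ZMod 14) | heawoodCycle ≤ X ∧ Nonempty (X ≃g heawood)} =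
      {heawood, heawood2} := by
    ext X
    simp only [Set.mem_ofPred_eq, Set.mem_insert_iff, Set.mem_singleton_iff]
    constructor
    · rintro ⟨hC, ⟨f⟩⟩
      exact ext_cases X hC f
    · rintro (rfl | rfl)
      · exact ⟨cyc_le, ⟨SimpleGraph.Iso.refl⟩⟩
      · exact ⟨cyc_le2, ⟨⟨Equiv.addRight 1, fun {a b} => hw_iso a b⟩⟩⟩
  have h2 : Set.ncard {X : SimpleGraph (ZMod 14) |
      heawoodCycle ≤ X ∧ Nonempty (X ≃g heawood)} = 2 := by
    rw [hs, Set.ncard_pair hw_ne]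
  exact h2
end

section
/- The Heawood graph contains exactly 24 hamiltonian cycles; that is, the number of connected 2-regular spanning subgraphs of the Heawood graph is 24. -/
def hwCodes : List ℕ := [0, 2025, 675, 225, 1326, 876, 75, 2100, 1792, 442, 1093, 292, 826, 25, 2050, 700, 1703, 1928, 1004, 1778, 737, 1412, 962, 2186]

/-- missing direction of the even vertex `2 i` in the `k`-th cycle -/
def hwT (k : Fin 24) (i : ℕ) : ℕ := (hwCodes.getD k.val 0 / 3 ^ i) % 3

def hwDir (k : Fin 24) (v w : ℕ) : Bool :=
  v % 2 == 0 && ((hwT k (v / 2) != 0 && w == (v + 1) % 14) ||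
    (hwT k (v / 2) != 1 && w == (v + 5) % 14) ||
    (hwT k (v / 2) != 2 && w == (v + 13) % 14))

def hwA (k : Fin 24) (v w : ℕ) : Bool := hwDir k v w || hwDir k w v

def hwOff (e : Fin 3) : ZMod 14 := if e = 0 then 1 else if e = 1 then 5 else 13

def hwN (u : ZMod 14) (e : Fin 3) : ZMod 14 :=
  if u.val % 2 = 0 then u + hwOff e else u - hwOff e

theorem hwN_inj : ∀ u e e', hwN u e = hwN u e' → e = e' := by decide +kernel

theorem hwN_inv : ∀ u e, hwN (hwN u e) e = u := by decide +kernel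

theorem heawood_iff : ∀ u w, heawood.Adj u w ↔ ∃ e, w = hwN u e := by
  simp only [heawood, SimpleGraph.fromRel_adj]
  decide +kernel

def hwG (k : Fin 24) : SimpleGraph (ZMod 14) where
  Adj v w := hwA k v.val w.val = true
  symm := ⟨fun v w h => by simpa [hwA, Bool.or_comm] using h⟩
  loopless := ⟨by revert k; decide +kernel⟩

instance (k : Fin 24) : DecidableRel (hwG k).Adj := fun v w =>
  inferInstanceAs (Decidable (hwA k v.val w.val = true))

theorem hwG_le (k : Fin 24) : hwG k ≤ heawood := by
  intro v w h
  rw [heawood_iff]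
  revert k v w
  decide +kernel

theorem hwG_adj : ∀ (k : Fin 24) (u : ZMod 14) (e : Fin 3), u.val % 2 = 0 →
    ((hwG k).Adj u (hwN u e) ↔ e.val ≠ hwT k (u.val / 2)) := by
  decide +kernel

theorem hwG_deg (k : Fin 24) (v : ZMod 14) : Nat.card {w // (hwG k).Adj v w} = 2 := by
  rw [Nat.card_eq_fintype_card, Fintype.card_subtype]
  revert k v
  decide +kernel

def hwAll : List (ZMod 14) := List.finRange 14

def hwReach (k : Fin 24) : ℕ → List (ZMod 14)
  | 0 => [0]
  | n + 1 => hwAll.filter fun w : ZMod 14 =>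
      decide (w ∈ hwReach k n) || (hwReach k n).any fun v => hwA k v.val w.val

theorem hwReach_reach (k : Fin 24) (n : ℕ) : ∀ w ∈ hwReach k n, (hwG k).Reachable 0 w := by
  induction n with
  | zero => intro w hw; simp [hwReach] at hw; subst hw; exact SimpleGraph.Reachable.refl _
  | succ n ih =>
    intro w hw
    simp only [hwReach, List.mem_filter, Bool.or_eq_true, decide_eq_true_eq, List.any_eq_true] at hw
    rcases hw.2 with h | ⟨v, hv, h⟩
    · exact ih w h
    · exact (ih v hv).trans (SimpleGraph.Adj.reachable (show (hwG k).Adj v w from h))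

theorem hwReach_all : ∀ k (w : ZMod 14), w ∈ hwReach k 7 := by decide +kernel

theorem hwG_conn (k : Fin 24) : (hwG k).Connected where
  preconnected u v := (hwReach_reach k 7 u (hwReach_all k u)).symm.trans
    (hwReach_reach k 7 v (hwReach_all k v))
  nonempty := ⟨0⟩

theorem hwT_inj : ∀ k k' : Fin 24, (∀ i : Fin 7, hwT k i = hwT k' i) → k = k' := by
  decide +kernel

theorem hwT_lt (k : Fin 24) (i : ℕ) : hwT k i < 3 := Nat.mod_lt _ (by norm_num)

set_option synthInstance.maxSize 100000 in
set_option synthInstance.maxHeartbeats 2000000 in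
set_option maxRecDepth 100000 in
theorem hw_search : ∀ a b : Fin 3, hwN 0 a ≠ hwN 2 b →
    ∀ c, hwN 0 a ≠ hwN 4 c → hwN 2 b ≠ hwN 4 c →
    ∀ d, hwN 0 a ≠ hwN 6 d → hwN 2 b ≠ hwN 6 d → hwN 4 c ≠ hwN 6 d →
    ∀ e, hwN 0 a ≠ hwN 8 e → hwN 2 b ≠ hwN 8 e → hwN 4 c ≠ hwN 8 e → hwN 6 d ≠ hwN 8 e →
    ∀ f, hwN 0 a ≠ hwN 10 f → hwN 2 b ≠ hwN 10 f → hwN 4 c ≠ hwN 10 f → hwN 6 d ≠ hwN 10 f →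
      hwN 8 e ≠ hwN 10 f →
    ∀ g, hwN 0 a ≠ hwN 12 g → hwN 2 b ≠ hwN 12 g → hwN 4 c ≠ hwN 12 g → hwN 6 d ≠ hwN 12 g →
      hwN 8 e ≠ hwN 12 g → hwN 10 f ≠ hwN 12 g →
    ∃ k, hwT k 0 = a ∧ hwT k 1 = b ∧ hwT k 2 = c ∧ hwT k 3 = d ∧ hwT k 4 = e ∧ hwT k 5 = f ∧
      hwT k 6 = g := by
  decide +kernel

theorem hw_three (P : Fin 3 → Prop) (h : Nat.card {e // P e} = 2) : ∃ d, ∀ e, P e ↔ e ≠ d := by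
  classical
  rw [Nat.card_eq_fintype_card, Fintype.card_subtype] at h
  have h1 : (Finset.univ.filter P)ᶜ.card = 1 := by
    rw [Finset.card_compl, h]; rfl
  obtain ⟨d, hd⟩ := Finset.card_eq_one.1 h1
  refine ⟨d, fun e => ?_⟩
  have := Finset.ext_iff.1 hd e
  simp at this
  tauto

theorem hw_miss (C : SimpleGraph (ZMod 14)) (hC : IsHamCycle heawood C) (u : ZMod 14) :
    ∃ d, ∀ e, C.Adj u (hwN u e) ↔ e ≠ d := by
  apply hw_three
  rw [← hC.2.2 u]
  refine Nat.card_eq_of_bijective (fun x => ⟨hwN u x.1, x.2⟩) ⟨?_, ?_⟩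
  · intro x y h
    exact Subtype.ext (hwN_inj u _ _ (congrArg Subtype.val h))
  · rintro ⟨w, hw⟩
    obtain ⟨e, rfl⟩ := (heawood_iff u w).1 (hC.1 hw)
    exact ⟨⟨e, hw⟩, rfl⟩

theorem hw_ext (C D : SimpleGraph (ZMod 14)) (hC : C ≤ heawood) (hD : D ≤ heawood)
    (h : ∀ u : ZMod 14, u.val % 2 = 0 → ∀ e, C.Adj u (hwN u e) ↔ D.Adj u (hwN u e)) : C = D := by
  have par : ∀ u e, ¬ u.val % 2 = 0 → (hwN u e).val % 2 = 0 := by decide +kernel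
  have key : ∀ u e, C.Adj u (hwN u e) ↔ D.Adj u (hwN u e) := by
    intro u e
    by_cases hu : u.val % 2 = 0
    · exact h u hu e
    · have := h (hwN u e) (par u e hu) e
      rw [hwN_inv] at this
      rw [C.adj_comm, D.adj_comm, this]
  ext u w
  constructor
  · intro hh
    obtain ⟨e, rfl⟩ := (heawood_iff u w).1 (hC hh)
    exact (key u e).1 hh
  · intro hh
    obtain ⟨e, rfl⟩ := (heawood_iff u w).1 (hD hh)
    exact (key u e).2 hh

theorem hw_surj (C : SimpleGraph (ZMod 14)) (hC : IsHamCycle heawood C) : ∃ k, hwG k = C := by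
  choose g hg using hw_miss C hC
  have cons : ∀ u, g (hwN u (g u)) = g u := by
    intro u
    by_contra hne
    have h1 := (hg (hwN u (g u)) (g u)).2 (Ne.symm hne)
    rw [hwN_inv, C.adj_comm] at h1
    exact (hg u (g u)).1 h1 rfl
  have ne : ∀ u v, u ≠ v → hwN u (g u) ≠ hwN v (g v) := by
    intro u v huv h
    have e : g u = g v := by rw [← cons u, h, cons v]
    apply huv
    rw [← hwN_inv u (g u), h, e, hwN_inv]
  have D : ∀ u v : ZMod 14, decide (u = v) = false → hwN u (g u) ≠ hwN v (g v) :=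
    fun u v h => ne u v (by simpa using h)
  obtain ⟨k, h0, h1, h2, h3, h4, h5, h6⟩ := hw_search (g 0) (g 2) (D _ _ rfl)
    (g 4) (D _ _ rfl) (D _ _ rfl) (g 6) (D _ _ rfl) (D _ _ rfl) (D _ _ rfl)
    (g 8) (D _ _ rfl) (D _ _ rfl) (D _ _ rfl) (D _ _ rfl)
    (g 10) (D _ _ rfl) (D _ _ rfl) (D _ _ rfl) (D _ _ rfl) (D _ _ rfl)
    (g 12) (D _ _ rfl) (D _ _ rfl) (D _ _ rfl) (D _ _ rfl) (D _ _ rfl) (D _ _ rfl)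
  have ev : ∀ u : ZMod 14, u.val % 2 = 0 →
      u = 0 ∨ u = 2 ∨ u = 4 ∨ u = 6 ∨ u = 8 ∨ u = 10 ∨ u = 12 := by decide +kernel
  refine ⟨k, hw_ext _ _ (hwG_le k) hC.1 fun u hu e => ?_⟩
  rw [hwG_adj k u e hu, hg]
  have : hwT k (u.val / 2) = g u := by
    rcases ev u hu with rfl | rfl | rfl | rfl | rfl | rfl | rfl
    exacts [h0, h1, h2, h3, h4, h5, h6]
  rw [this, Ne, Ne, Fin.val_inj]

theorem hwG_inj (k k' : Fin 24) (h : hwG k = hwG k') : k = k' := by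
  apply hwT_inj
  intro i
  have hv : ∀ i : Fin 7, ((2 * i.val : ℕ) : ZMod 14).val = 2 * i.val := by decide +kernel
  have hu : ((2 * i.val : ℕ) : ZMod 14).val % 2 = 0 := by rw [hv]; omega
  have hd : ((2 * i.val : ℕ) : ZMod 14).val / 2 = i := by rw [hv]; omega
  have a := hwG_adj k _ ⟨_, hwT_lt k i⟩ hu
  have b := hwG_adj k' _ ⟨_, hwT_lt k i⟩ hu
  rw [hd] at a b
  rw [h] at a
  by_contra hne
  exact a.1 (b.2 hne) rfl

/-- The Heawood graph contains exactly 24 hamiltonian cycles. -/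
theorem heawood_hamCycles :
    Nat.card {C : SimpleGraph (ZMod 14) // IsHamCycle heawood C} = 24 := by
  have h : Nat.card (Fin 24) = Nat.card {C : SimpleGraph (ZMod 14) // IsHamCycle heawood C} := by
    refine Nat.card_eq_of_bijective
      (fun k => ⟨hwG k, hwG_le k, hwG_conn k, hwG_deg k⟩) ⟨?_, ?_⟩
    · intro k k' h
      exact hwG_inj k k' (congrArg Subtype.val h)
    · rintro ⟨C, hC⟩
      obtain ⟨k, hk⟩ := hw_surj C hC
      exact ⟨k, Subtype.ext hk⟩
  rw [← h, Nat.card_eq_fintype_card, Fintype.card_fin]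
end

section
/- The dodecahedral graph G(10,2) contains exactly 30 hamiltonian cycles, its automorphism group has order 120, the stabilizer in A(G(10,2)) of any fixed hamiltonian cycle C (i.e., A(C) ∩ A(G(10,2))) has order 4, and consequently G(10,2) ∈ F(HAM). -/
namespace Dodec

abbrev W := ZMod 10 ⊕ ZMod 10

def ix : W → ℕ
  | Sum.inl i => 2 * i.val
  | Sum.inr i => 2 * i.val + 1

def vx (n : ℕ) : W :=
  bif Nat.beq (n % 2) 0 then Sum.inl ((n / 2 : ℕ) : ZMod 10) else Sum.inr ((n / 2 : ℕ) : ZMod 10)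

theorem vx_ix : ∀ v, vx (ix v) = v := by decide +kernel
theorem ix_lt : ∀ v, ix v < 20 := by decide +kernel
theorem ix_vx : ∀ n < 20, ix (vx n) = n := by decide +kernel
theorem ix_inj {v w : W} (h : ix v = ix w) : v = w := by rw [← vx_ix v, h, vx_ix]

def gmask : ℕ := 726278864444335259911259211516803338499415098391041372802457228461379675345259646187076993811912068778369504950170681350

def gA (i j : ℕ) : Bool :=
  Nat.beq (Nat.land (Nat.shiftRight gmask (Nat.add (Nat.mul 20 i) j)) 1) 1

/-- edges of the dodecahedron, in a good search order -/
def E : List (ℕ × ℕ) :=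
  [(10, 11), (10, 12), (12, 13), (9, 13), (8, 10), (8, 9), (11, 15), (12, 14), (14, 15), (7, 11),
   (6, 8), (6, 7), (13, 17), (14, 16), (16, 17), (5, 9), (4, 6), (4, 5), (15, 19), (16, 18),
   (18, 19), (3, 7), (3, 19), (2, 4), (2, 3), (1, 17), (1, 5), (0, 18), (0, 2), (0, 1)]

abbrev G : SimpleGraph W := genPetersen 10 2

theorem G_adj (v w : W) : G.Adj v w ↔ gA (ix v) (ix w) = true := by
  rcases v with i | i <;> rcases w with j | j <;> simp only [G, genPetersen, SimpleGraph.fromRel_adj]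
  · revert i j; decide +kernel
  · revert i j; decide +kernel
  · revert i j; decide +kernel
  · revert i j; decide +kernel

/-- adjacency in the graph coded by an edge list -/
def cA (c : List (ℕ × ℕ)) (i j : ℕ) : Bool :=
  c.any fun e => (Nat.beq e.1 i && Nat.beq e.2 j) || (Nat.beq e.1 j && Nat.beq e.2 i)

theorem cA_iff (c : List (ℕ × ℕ)) (i j : ℕ) : cA c i j = true ↔ (i, j) ∈ c ∨ (j, i) ∈ c := by
  simp only [cA, List.any_eq_true, Bool.or_eq_true, Bool.and_eq_true, Nat.beq_eq]
  constructor
  · rintro ⟨⟨a, b⟩, h, ⟨rfl, rfl⟩ | ⟨rfl, rfl⟩⟩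
    · exact Or.inl h
    · exact Or.inr h
  · rintro (h | h)
    · exact ⟨_, h, Or.inl ⟨rfl, rfl⟩⟩
    · exact ⟨_, h, Or.inr ⟨rfl, rfl⟩⟩

theorem cA_comm (c : List (ℕ × ℕ)) (i j : ℕ) : cA c i j = cA c j i := by
  rw [Bool.eq_iff_iff, cA_iff, cA_iff, or_comm]

theorem gA_E : ∀ i < 20, ∀ j < 20, gA i j = cA E i j := by decide +kernel
theorem gA_irr : ∀ i < 20, gA i i = false := by decide +kernel
theorem E_lt : ∀ e ∈ E, e.1 < 20 ∧ e.2 < 20 := by decide +kernel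
theorem G_adj' (v w : W) : G.Adj v w ↔ cA E (ix v) (ix w) = true := by
  rw [G_adj, gA_E _ (ix_lt v) _ (ix_lt w)]

/-! ### Search for 2-regular spanning subgraphs -/

def inc (u : ℕ) (e : ℕ × ℕ) : Bool := Nat.beq e.1 u || Nat.beq e.2 u

def chk (s l : List (ℕ × ℕ)) (u : ℕ) : Bool :=
  Nat.blt (s.countP (inc u)) 3 || Nat.beq (l.countP (inc u)) 2

def ext : List (ℕ × ℕ) → List (List (ℕ × ℕ))
  | [] => [[]]
  | e :: s => (ext s).flatMap fun l =>
      [e :: l, l].filter fun m => chk (e :: s) m e.1 && chk (e :: s) m e.2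

theorem mem_ext (f : ℕ × ℕ → Bool) (s : List (ℕ × ℕ))
    (h : ∀ t, t <:+ s → ∀ e ∈ t, chk t (t.filter f) e.1 = true ∧ chk t (t.filter f) e.2 = true) :
    s.filter f ∈ ext s := by
  induction s with
  | nil => simp [ext]
  | cons e s ih =>
    rw [ext, List.mem_flatMap]
    refine ⟨s.filter f, ih fun t ht => h t (ht.trans (List.suffix_cons _ _)), ?_⟩
    rw [List.mem_filter]
    have := h (e :: s) List.suffix_rfl e (by simp)
    refine ⟨?_, by simpa using this⟩
    rw [List.filter_cons]; split <;> simp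

def N (u : ℕ) : List (ℕ × ℕ) := E.filter (inc u)
def other (u : ℕ) (e : ℕ × ℕ) : ℕ := bif Nat.beq e.1 u then e.2 else e.1
def nb (v : W) : List W := ((N (ix v)).map (other (ix v))).map vx

theorem nb_nodup : ∀ v, (nb v).Nodup := by decide +kernel
theorem nb_len : ∀ u < 20, (N u).length = 3 := by decide +kernel
theorem mem_nb_aux : ∀ v w : W, decide (∃ x ∈ nb v, x = w) = gA (ix v) (ix w) := by decide +kernel
theorem mem_nb (v w : W) : w ∈ nb v ↔ G.Adj v w := by
  rw [G_adj, ← mem_nb_aux, decide_eq_true_eq]; simp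

open Classical in
/-- code of a spanning subgraph -/
noncomputable def fC (C : SimpleGraph W) (e : ℕ × ℕ) : Bool := decide (C.Adj (vx e.1) (vx e.2))

noncomputable def code (C : SimpleGraph W) : List (ℕ × ℕ) := E.filter (fC C)

theorem deg_eq (C : SimpleGraph W) (hC : C ≤ G) (v : W) :
    Nat.card {w // C.Adj v w} = (N (ix v)).countP (fC C) := by
  classical
  have h1 : (N (ix v)).countP (fC C) = (nb v).countP (fun w => decide (C.Adj v w)) := by
    rw [nb, List.map_map, List.countP_map]
    apply List.countP_congr
    intro e he
    obtain ⟨he1, he2⟩ := List.mem_filter.1 he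
    simp only [inc, Bool.or_eq_true, Nat.beq_eq] at he2
    simp only [fC, Function.comp, decide_eq_true_eq, other]
    by_cases h : e.1 = ix v
    · simp [h, vx_ix]
    · have h' : Nat.beq e.1 (ix v) = false := by
        rw [Bool.eq_false_iff]; simpa [Nat.beq_eq] using h
      have h2 : e.2 = ix v := by tauto
      simp [h', h2, vx_ix, C.adj_comm]
  rw [h1, List.countP_eq_length_filter, ← List.toFinset_card_of_nodup ((nb_nodup v).filter _),
    Nat.card_eq_fintype_card, Fintype.card_subtype]
  congr 1
  ext w
  simp only [Finset.mem_filter, Finset.mem_univ, true_and, List.mem_toFinset, List.mem_filter,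
    decide_eq_true_eq, mem_nb]
  exact ⟨fun h => ⟨hC h, h⟩, fun h => h.2⟩

theorem code_mem (C : SimpleGraph W) (hC : C ≤ G) (hd : ∀ v, Nat.card {w // C.Adj v w} = 2) :
    code C ∈ ext E := by
  apply mem_ext
  have key : ∀ t, t <:+ E → ∀ u < 20, chk t (t.filter (fC C)) u = true := by
    intro t ht u hu
    simp only [chk, Bool.or_eq_true, Nat.beq_eq, Nat.blt_eq]
    by_cases h3 : t.countP (inc u) < 3
    · exact Or.inl h3
    · right
      have hs : (t.filter (inc u)).Sublist (N u) := ht.sublist.filter _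
      have : t.filter (inc u) = N u := by
        apply hs.eq_of_length_le
        rw [nb_len u hu, ← List.countP_eq_length_filter]; omega
      have h2 := hd (vx u)
      rw [deg_eq C hC, ix_vx u hu, ← this] at h2
      rw [List.countP_filter] at h2 ⊢
      rw [← h2]
      apply List.countP_congr; intro e _; simp [and_comm]
  intro t ht e he
  have := E_lt e (ht.subset he)
  exact ⟨key t ht _ this.1, key t ht _ this.2⟩

/-! ### Connectivity -/

def step (S : ℕ) (e : ℕ × ℕ) : ℕ :=
  bif Nat.testBit S e.1 || Nat.testBit S e.2 then S ||| (2 ^ e.1 ||| 2 ^ e.2) else S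

def reach (c : List (ℕ × ℕ)) : ℕ → ℕ
  | 0 => 1
  | n + 1 => c.foldl step (reach c n)

def conn (c : List (ℕ × ℕ)) : Bool := Nat.beq (reach c 10) 1048575

def H : List (List (ℕ × ℕ)) := (ext E).filter conn

theorem ext_good : ∀ c ∈ ext E, conn c = true ∨
    ((∀ e ∈ c, Nat.testBit (reach c 10) e.1 = Nat.testBit (reach c 10) e.2) ∧
    Nat.testBit (reach c 10) 0 = true ∧
    ∃ i ∈ List.range 20, Nat.testBit (reach c 10) i = false) := by decide +kernel
theorem full_bits : ∀ i < 20, Nat.testBit 1048575 i = true := by decide +kernel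
theorem H_all : H.length = 30 ∧ H.Nodup ∧ ∀ c ∈ H, (∀ e ∈ c, e ∈ E) ∧
    (E.filter fun e => cA c e.1 e.2) = c ∧
    ∀ u ∈ List.range 20, ((N u).countP fun e => cA c e.1 e.2) = 2 := by decide +kernel
theorem H_len : H.length = 30 := H_all.1
theorem H_nodup : H.Nodup := H_all.2.1
theorem H_sub (c) (hc : c ∈ H) : ∀ e ∈ c, e ∈ E := (H_all.2.2 c hc).1
theorem H_code (c) (hc : c ∈ H) : (E.filter fun e => cA c e.1 e.2) = c := (H_all.2.2 c hc).2.1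
theorem H_deg (c) (hc : c ∈ H) :
    ∀ u ∈ List.range 20, ((N u).countP fun e => cA c e.1 e.2) = 2 := (H_all.2.2 c hc).2.2

/-- graph coded by an edge list -/
def gr (c : List (ℕ × ℕ)) : SimpleGraph W := SimpleGraph.fromRel fun v w => (ix v, ix w) ∈ c

theorem gr_adj {c : List (ℕ × ℕ)} (hc : ∀ e ∈ c, e ∈ E) (v w : W) :
    (gr c).Adj v w ↔ cA c (ix v) (ix w) = true := by
  rw [gr, SimpleGraph.fromRel_adj, cA_iff]
  refine ⟨fun h => h.2, fun h => ⟨?_, h⟩⟩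
  have : G.Adj v w := by
    rw [G_adj', cA_iff]; exact h.imp (hc _) (hc _)
  exact this.ne

theorem gr_le {c : List (ℕ × ℕ)} (hc : ∀ e ∈ c, e ∈ E) : gr c ≤ G := by
  intro v w h
  rw [gr_adj hc, cA_iff] at h
  rw [G_adj', cA_iff]; exact h.imp (hc _) (hc _)

theorem code_sub (C : SimpleGraph W) : ∀ e ∈ code C, e ∈ E := fun _ he => (List.mem_filter.1 he).1

theorem gr_code {C : SimpleGraph W} (hC : C ≤ G) : gr (code C) = C := by
  ext v w
  rw [gr_adj (code_sub C), cA_iff]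
  simp only [code, List.mem_filter, fC, vx_ix, decide_eq_true_eq]
  constructor
  · rintro (h | h)
    · exact h.2
    · exact h.2.symm
  · intro h
    have := hC h
    rw [G_adj', cA_iff] at this
    exact this.imp (fun a => ⟨a, h⟩) (fun a => ⟨a, h.symm⟩)

theorem C_adj {C : SimpleGraph W} (hC : C ≤ G) (v w : W) :
    C.Adj v w ↔ cA (code C) (ix v) (ix w) = true := by
  rw [← gr_adj (code_sub C), gr_code hC]

theorem fC_gr {c : List (ℕ × ℕ)} (hc : ∀ e ∈ c, e ∈ E) (e : ℕ × ℕ) (he : e ∈ E) :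
    fC (gr c) e = cA c e.1 e.2 := by
  have := E_lt e he
  rw [Bool.eq_iff_iff, fC, @decide_eq_true_iff _ (_), gr_adj hc, ix_vx _ this.1, ix_vx _ this.2]

theorem code_gr {c : List (ℕ × ℕ)} (hc : c ∈ H) : code (gr c) = c := by
  conv_rhs => rw [← H_code c hc]
  exact List.filter_congr fun e he => fC_gr (H_sub c hc) e he

theorem reach_sound (C : SimpleGraph W) (n : ℕ) :
    ∀ i, Nat.testBit (reach (code C) n) i = true → C.Reachable (vx 0) (vx i) := by
  have fold : ∀ (l : List (ℕ × ℕ)), (∀ e ∈ l, e ∈ code C) → ∀ S : ℕ,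
      (∀ i, Nat.testBit S i = true → C.Reachable (vx 0) (vx i)) →
      ∀ i, Nat.testBit (l.foldl step S) i = true → C.Reachable (vx 0) (vx i) := by
    intro l
    induction l with
    | nil => intro _ S hS; exact hS
    | cons e l ih =>
      intro hl S hS
      apply ih (fun e he => hl e (List.mem_cons_of_mem _ he))
      have he : C.Adj (vx e.1) (vx e.2) := by
        have := (List.mem_filter.1 (hl e (by simp))).2
        simpa [fC] using this
      intro i hi
      unfold step at hi
      cases hb : (Nat.testBit S e.1 || Nat.testBit S e.2) with
      | false => rw [hb] at hi; exact hS i hi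
      | true =>
        rw [hb] at hi
        have h12 : C.Reachable (vx 0) (vx e.1) ∧ C.Reachable (vx 0) (vx e.2) := by
          rw [Bool.or_eq_true] at hb
          rcases hb with h | h
          · exact ⟨hS _ h, (hS _ h).trans he.reachable⟩
          · exact ⟨(hS _ h).trans he.symm.reachable, hS _ h⟩
        simp only [cond_true, Nat.testBit_or, Nat.testBit_two_pow, Bool.or_eq_true,
          decide_eq_true_eq] at hi
        rcases hi with h | rfl | rfl
        · exact hS i h
        · exact h12.1
        · exact h12.2
  induction n with
  | zero =>
    intro i hi
    have : i = 0 := by simpa [reach, Nat.testBit_one_eq_true_iff_self_eq_zero] using hi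
    subst this; exact SimpleGraph.Reachable.refl _
  | succ n ih => exact fold _ (fun _ h => h) _ ih

theorem code_mem_H {C : SimpleGraph W} (h : IsHamCycle G C) : code C ∈ H := by
  obtain ⟨hC, hconn, hd⟩ := h
  have hm := code_mem C hC hd
  refine List.mem_filter.2 ⟨hm, ?_⟩
  rcases ext_good _ hm with h | ⟨h1, h2, i, hi, h3⟩
  · exact h
  · exfalso
    set S := reach (code C) 10
    have hstep : ∀ v w, C.Adj v w → S.testBit (ix v) = S.testBit (ix w) := by
      intro v w hvw
      rw [C_adj hC, cA_iff] at hvw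
      rcases hvw with h | h
      · exact h1 _ h
      · exact (h1 _ h).symm
    have hwalk : ∀ v w, C.Walk v w → S.testBit (ix v) = S.testBit (ix w) := by
      intro v w p
      induction p with
      | nil => rfl
      | cons h _ ih => rw [hstep _ _ h, ih]
    obtain ⟨p⟩ := hconn.preconnected (vx 0) (vx i)
    have := hwalk _ _ p
    rw [ix_vx 0 (by norm_num), ix_vx i (by simpa using hi), h2, h3] at this
    exact absurd this (by decide)

theorem gr_ham {c : List (ℕ × ℕ)} (hc : c ∈ H) : IsHamCycle G (gr c) := by
  have hs := H_sub c hc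
  refine ⟨gr_le hs, ?_, ?_⟩
  · have h0 : ∀ v, (gr c).Reachable (vx 0) v := by
      intro v
      have := reach_sound (gr c) 10 (ix v)
      rw [vx_ix] at this
      apply this
      rw [code_gr hc]
      have h1 := (List.mem_filter.1 hc).2
      rw [conn, Nat.beq_eq] at h1
      rw [h1]
      exact full_bits _ (ix_lt v)
    exact SimpleGraph.Connected.mk (fun v w => (h0 v).symm.trans (h0 w))
  · intro v
    rw [deg_eq _ (gr_le hs), ← H_deg c hc (ix v) (by simpa using ix_lt v)]
    apply List.countP_congr
    intro e he
    rw [fC_gr hs e (List.mem_filter.1 he).1]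

theorem card_list {α : Type*} {l : List α} (h : l.Nodup) : Nat.card {x // x ∈ l} = l.length := by
  classical
  rw [← List.toFinset_card_of_nodup h, ← Nat.card_eq_finsetCard]
  exact Nat.card_congr (Equiv.subtypeEquivRight fun x => by simp)

theorem card_ham : Nat.card {C : SimpleGraph W // IsHamCycle G C} = 30 := by
  rw [← H_len, ← card_list H_nodup]
  refine Nat.card_congr ⟨fun C => ⟨code C.1, code_mem_H C.2⟩, fun c => ⟨gr c.1, gr_ham c.2⟩, ?_, ?_⟩
  · intro C; exact Subtype.ext (gr_code C.2.1)
  · intro c; exact Subtype.ext (code_gr c.2)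

/-! ### Automorphisms -/

def agree (a b : Bool) : Bool := bif a then b else !b

theorem agree_self (a : Bool) : agree a a = true := by cases a <;> rfl

def pre (v x : ℕ) : List ℕ → List ℕ → Bool
  | _ :: u :: _, _ :: y :: _ => agree (gA x y) (gA v u)
  | _, _ => true

def chk2 (v x : ℕ) : List ℕ → List ℕ → Bool
  | u :: s, y :: l => agree (gA x y) (gA v u) && (!Nat.beq x y && chk2 v x s l)
  | _, _ => true

def ext2 : List ℕ → List (List ℕ)
  | [] => [[]]
  | v :: s => (ext2 s).flatMap fun l =>
      ((List.range 20).filter fun x => pre v x s l && chk2 v x s l).map fun x => x :: l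

def R : List ℕ := [19, 18, 17, 16, 15, 14, 13, 12, 11, 10, 9, 8, 7, 6, 5, 4, 3, 2, 1, 0]

def L : List (List ℕ) :=
  [[19, 18, 17, 16, 15, 14, 13, 12, 11, 10, 9, 8, 7, 6, 5, 4, 3, 2, 1, 0],
   [3, 2, 5, 4, 7, 6, 9, 8, 11, 10, 13, 12, 15, 14, 17, 16, 19, 18, 1, 0],
   [16, 18, 3, 19, 14, 15, 7, 11, 12, 10, 6, 8, 13, 9, 4, 5, 17, 1, 2, 0],
   [17, 1, 4, 5, 13, 9, 6, 8, 12, 10, 7, 11, 14, 15, 3, 19, 16, 18, 2, 0],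
   [4, 2, 19, 3, 6, 7, 15, 11, 8, 10, 14, 12, 9, 13, 16, 17, 5, 1, 18, 0],
   [5, 1, 16, 17, 9, 13, 14, 12, 8, 10, 15, 11, 6, 7, 19, 3, 4, 2, 18, 0],
   [13, 17, 18, 16, 12, 14, 19, 15, 10, 11, 3, 7, 8, 6, 2, 4, 9, 5, 0, 1],
   [9, 5, 2, 4, 8, 6, 3, 7, 10, 11, 19, 15, 12, 14, 18, 16, 13, 17, 0, 1],
   [16, 17, 9, 13, 14, 12, 8, 10, 15, 11, 6, 7, 19, 3, 4, 2, 18, 0, 5, 1],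
   [18, 0, 4, 2, 19, 3, 6, 7, 15, 11, 8, 10, 14, 12, 9, 13, 16, 17, 5, 1],
   [4, 5, 13, 9, 6, 8, 12, 10, 7, 11, 14, 15, 3, 19, 16, 18, 2, 0, 17, 1],
   [2, 0, 16, 18, 3, 19, 14, 15, 7, 11, 12, 10, 6, 8, 13, 9, 4, 5, 17, 1],
   [6, 4, 1, 5, 8, 9, 17, 13, 10, 12, 16, 14, 11, 15, 18, 19, 7, 3, 0, 2],
   [7, 3, 18, 19, 11, 15, 16, 14, 10, 12, 17, 13, 8, 9, 1, 5, 6, 4, 0, 2],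
   [5, 4, 7, 6, 9, 8, 11, 10, 13, 12, 15, 14, 17, 16, 19, 18, 1, 0, 3, 2],
   [1, 0, 19, 18, 17, 16, 15, 14, 13, 12, 11, 10, 9, 8, 7, 6, 5, 4, 3, 2],
   [19, 3, 6, 7, 15, 11, 8, 10, 14, 12, 9, 13, 16, 17, 5, 1, 18, 0, 4, 2],
   [18, 0, 5, 1, 16, 17, 9, 13, 14, 12, 8, 10, 15, 11, 6, 7, 19, 3, 4, 2],
   [15, 19, 0, 18, 14, 16, 1, 17, 12, 13, 5, 9, 10, 8, 4, 6, 11, 7, 2, 3],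
   [11, 7, 4, 6, 10, 8, 5, 9, 12, 13, 1, 17, 14, 16, 0, 18, 15, 19, 2, 3],
   [18, 19, 11, 15, 16, 14, 10, 12, 17, 13, 8, 9, 1, 5, 6, 4, 0, 2, 7, 3],
   [0, 2, 6, 4, 1, 5, 8, 9, 17, 13, 10, 12, 16, 14, 11, 15, 18, 19, 7, 3],
   [6, 7, 15, 11, 8, 10, 14, 12, 9, 13, 16, 17, 5, 1, 18, 0, 4, 2, 19, 3],
   [4, 2, 18, 0, 5, 1, 16, 17, 9, 13, 14, 12, 8, 10, 15, 11, 6, 7, 19, 3],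
   [8, 6, 3, 7, 10, 11, 19, 15, 12, 14, 18, 16, 13, 17, 0, 1, 9, 5, 2, 4],
   [9, 5, 0, 1, 13, 17, 18, 16, 12, 14, 19, 15, 10, 11, 3, 7, 8, 6, 2, 4],
   [7, 6, 9, 8, 11, 10, 13, 12, 15, 14, 17, 16, 19, 18, 1, 0, 3, 2, 5, 4],
   [3, 2, 1, 0, 19, 18, 17, 16, 15, 14, 13, 12, 11, 10, 9, 8, 7, 6, 5, 4],
   [1, 5, 8, 9, 17, 13, 10, 12, 16, 14, 11, 15, 18, 19, 7, 3, 0, 2, 6, 4],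
   [0, 2, 7, 3, 18, 19, 11, 15, 16, 14, 10, 12, 17, 13, 8, 9, 1, 5, 6, 4],
   [8, 9, 17, 13, 10, 12, 16, 14, 11, 15, 18, 19, 7, 3, 0, 2, 6, 4, 1, 5],
   [6, 4, 0, 2, 7, 3, 18, 19, 11, 15, 16, 14, 10, 12, 17, 13, 8, 9, 1, 5],
   [13, 9, 6, 8, 12, 10, 7, 11, 14, 15, 3, 19, 16, 18, 2, 0, 17, 1, 4, 5],
   [17, 1, 2, 0, 16, 18, 3, 19, 14, 15, 7, 11, 12, 10, 6, 8, 13, 9, 4, 5],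
   [2, 4, 8, 6, 3, 7, 10, 11, 19, 15, 12, 14, 18, 16, 13, 17, 0, 1, 9, 5],
   [0, 1, 13, 17, 18, 16, 12, 14, 19, 15, 10, 11, 3, 7, 8, 6, 2, 4, 9, 5],
   [10, 8, 5, 9, 12, 13, 1, 17, 14, 16, 0, 18, 15, 19, 2, 3, 11, 7, 4, 6],
   [11, 7, 2, 3, 15, 19, 0, 18, 14, 16, 1, 17, 12, 13, 5, 9, 10, 8, 4, 6],
   [9, 8, 11, 10, 13, 12, 15, 14, 17, 16, 19, 18, 1, 0, 3, 2, 5, 4, 7, 6],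
   [5, 4, 3, 2, 1, 0, 19, 18, 17, 16, 15, 14, 13, 12, 11, 10, 9, 8, 7, 6],
   [3, 7, 10, 11, 19, 15, 12, 14, 18, 16, 13, 17, 0, 1, 9, 5, 2, 4, 8, 6],
   [2, 4, 9, 5, 0, 1, 13, 17, 18, 16, 12, 14, 19, 15, 10, 11, 3, 7, 8, 6],
   [10, 11, 19, 15, 12, 14, 18, 16, 13, 17, 0, 1, 9, 5, 2, 4, 8, 6, 3, 7],
   [8, 6, 2, 4, 9, 5, 0, 1, 13, 17, 18, 16, 12, 14, 19, 15, 10, 11, 3, 7],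
   [15, 11, 8, 10, 14, 12, 9, 13, 16, 17, 5, 1, 18, 0, 4, 2, 19, 3, 6, 7],
   [19, 3, 4, 2, 18, 0, 5, 1, 16, 17, 9, 13, 14, 12, 8, 10, 15, 11, 6, 7],
   [4, 6, 10, 8, 5, 9, 12, 13, 1, 17, 14, 16, 0, 18, 15, 19, 2, 3, 11, 7],
   [2, 3, 15, 19, 0, 18, 14, 16, 1, 17, 12, 13, 5, 9, 10, 8, 4, 6, 11, 7],
   [12, 10, 7, 11, 14, 15, 3, 19, 16, 18, 2, 0, 17, 1, 4, 5, 13, 9, 6, 8],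
   [13, 9, 4, 5, 17, 1, 2, 0, 16, 18, 3, 19, 14, 15, 7, 11, 12, 10, 6, 8],
   [11, 10, 13, 12, 15, 14, 17, 16, 19, 18, 1, 0, 3, 2, 5, 4, 7, 6, 9, 8],
   [7, 6, 5, 4, 3, 2, 1, 0, 19, 18, 17, 16, 15, 14, 13, 12, 11, 10, 9, 8],
   [5, 9, 12, 13, 1, 17, 14, 16, 0, 18, 15, 19, 2, 3, 11, 7, 4, 6, 10, 8],
   [4, 6, 11, 7, 2, 3, 15, 19, 0, 18, 14, 16, 1, 17, 12, 13, 5, 9, 10, 8],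
   [12, 13, 1, 17, 14, 16, 0, 18, 15, 19, 2, 3, 11, 7, 4, 6, 10, 8, 5, 9],
   [10, 8, 4, 6, 11, 7, 2, 3, 15, 19, 0, 18, 14, 16, 1, 17, 12, 13, 5, 9],
   [17, 13, 10, 12, 16, 14, 11, 15, 18, 19, 7, 3, 0, 2, 6, 4, 1, 5, 8, 9],
   [1, 5, 6, 4, 0, 2, 7, 3, 18, 19, 11, 15, 16, 14, 10, 12, 17, 13, 8, 9],
   [6, 8, 12, 10, 7, 11, 14, 15, 3, 19, 16, 18, 2, 0, 17, 1, 4, 5, 13, 9],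
   [4, 5, 17, 1, 2, 0, 16, 18, 3, 19, 14, 15, 7, 11, 12, 10, 6, 8, 13, 9],
   [14, 12, 9, 13, 16, 17, 5, 1, 18, 0, 4, 2, 19, 3, 6, 7, 15, 11, 8, 10],
   [15, 11, 6, 7, 19, 3, 4, 2, 18, 0, 5, 1, 16, 17, 9, 13, 14, 12, 8, 10],
   [13, 12, 15, 14, 17, 16, 19, 18, 1, 0, 3, 2, 5, 4, 7, 6, 9, 8, 11, 10],
   [9, 8, 7, 6, 5, 4, 3, 2, 1, 0, 19, 18, 17, 16, 15, 14, 13, 12, 11, 10],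
   [7, 11, 14, 15, 3, 19, 16, 18, 2, 0, 17, 1, 4, 5, 13, 9, 6, 8, 12, 10],
   [6, 8, 13, 9, 4, 5, 17, 1, 2, 0, 16, 18, 3, 19, 14, 15, 7, 11, 12, 10],
   [14, 15, 3, 19, 16, 18, 2, 0, 17, 1, 4, 5, 13, 9, 6, 8, 12, 10, 7, 11],
   [12, 10, 6, 8, 13, 9, 4, 5, 17, 1, 2, 0, 16, 18, 3, 19, 14, 15, 7, 11],
   [19, 15, 12, 14, 18, 16, 13, 17, 0, 1, 9, 5, 2, 4, 8, 6, 3, 7, 10, 11],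
   [3, 7, 8, 6, 2, 4, 9, 5, 0, 1, 13, 17, 18, 16, 12, 14, 19, 15, 10, 11],
   [8, 10, 14, 12, 9, 13, 16, 17, 5, 1, 18, 0, 4, 2, 19, 3, 6, 7, 15, 11],
   [6, 7, 19, 3, 4, 2, 18, 0, 5, 1, 16, 17, 9, 13, 14, 12, 8, 10, 15, 11],
   [16, 14, 11, 15, 18, 19, 7, 3, 0, 2, 6, 4, 1, 5, 8, 9, 17, 13, 10, 12],
   [17, 13, 8, 9, 1, 5, 6, 4, 0, 2, 7, 3, 18, 19, 11, 15, 16, 14, 10, 12],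
   [15, 14, 17, 16, 19, 18, 1, 0, 3, 2, 5, 4, 7, 6, 9, 8, 11, 10, 13, 12],
   [11, 10, 9, 8, 7, 6, 5, 4, 3, 2, 1, 0, 19, 18, 17, 16, 15, 14, 13, 12],
   [9, 13, 16, 17, 5, 1, 18, 0, 4, 2, 19, 3, 6, 7, 15, 11, 8, 10, 14, 12],
   [8, 10, 15, 11, 6, 7, 19, 3, 4, 2, 18, 0, 5, 1, 16, 17, 9, 13, 14, 12],
   [16, 17, 5, 1, 18, 0, 4, 2, 19, 3, 6, 7, 15, 11, 8, 10, 14, 12, 9, 13],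
   [14, 12, 8, 10, 15, 11, 6, 7, 19, 3, 4, 2, 18, 0, 5, 1, 16, 17, 9, 13],
   [1, 17, 14, 16, 0, 18, 15, 19, 2, 3, 11, 7, 4, 6, 10, 8, 5, 9, 12, 13],
   [5, 9, 10, 8, 4, 6, 11, 7, 2, 3, 15, 19, 0, 18, 14, 16, 1, 17, 12, 13],
   [10, 12, 16, 14, 11, 15, 18, 19, 7, 3, 0, 2, 6, 4, 1, 5, 8, 9, 17, 13],
   [8, 9, 1, 5, 6, 4, 0, 2, 7, 3, 18, 19, 11, 15, 16, 14, 10, 12, 17, 13],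
   [18, 16, 13, 17, 0, 1, 9, 5, 2, 4, 8, 6, 3, 7, 10, 11, 19, 15, 12, 14],
   [19, 15, 10, 11, 3, 7, 8, 6, 2, 4, 9, 5, 0, 1, 13, 17, 18, 16, 12, 14],
   [17, 16, 19, 18, 1, 0, 3, 2, 5, 4, 7, 6, 9, 8, 11, 10, 13, 12, 15, 14],
   [13, 12, 11, 10, 9, 8, 7, 6, 5, 4, 3, 2, 1, 0, 19, 18, 17, 16, 15, 14],
   [11, 15, 18, 19, 7, 3, 0, 2, 6, 4, 1, 5, 8, 9, 17, 13, 10, 12, 16, 14],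
   [10, 12, 17, 13, 8, 9, 1, 5, 6, 4, 0, 2, 7, 3, 18, 19, 11, 15, 16, 14],
   [18, 19, 7, 3, 0, 2, 6, 4, 1, 5, 8, 9, 17, 13, 10, 12, 16, 14, 11, 15],
   [16, 14, 10, 12, 17, 13, 8, 9, 1, 5, 6, 4, 0, 2, 7, 3, 18, 19, 11, 15],
   [3, 19, 16, 18, 2, 0, 17, 1, 4, 5, 13, 9, 6, 8, 12, 10, 7, 11, 14, 15],
   [7, 11, 12, 10, 6, 8, 13, 9, 4, 5, 17, 1, 2, 0, 16, 18, 3, 19, 14, 15],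
   [12, 14, 18, 16, 13, 17, 0, 1, 9, 5, 2, 4, 8, 6, 3, 7, 10, 11, 19, 15],
   [10, 11, 3, 7, 8, 6, 2, 4, 9, 5, 0, 1, 13, 17, 18, 16, 12, 14, 19, 15],
   [0, 18, 15, 19, 2, 3, 11, 7, 4, 6, 10, 8, 5, 9, 12, 13, 1, 17, 14, 16],
   [1, 17, 12, 13, 5, 9, 10, 8, 4, 6, 11, 7, 2, 3, 15, 19, 0, 18, 14, 16],
   [19, 18, 1, 0, 3, 2, 5, 4, 7, 6, 9, 8, 11, 10, 13, 12, 15, 14, 17, 16],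
   [15, 14, 13, 12, 11, 10, 9, 8, 7, 6, 5, 4, 3, 2, 1, 0, 19, 18, 17, 16],
   [13, 17, 0, 1, 9, 5, 2, 4, 8, 6, 3, 7, 10, 11, 19, 15, 12, 14, 18, 16],
   [12, 14, 19, 15, 10, 11, 3, 7, 8, 6, 2, 4, 9, 5, 0, 1, 13, 17, 18, 16],
   [14, 16, 0, 18, 15, 19, 2, 3, 11, 7, 4, 6, 10, 8, 5, 9, 12, 13, 1, 17],
   [12, 13, 5, 9, 10, 8, 4, 6, 11, 7, 2, 3, 15, 19, 0, 18, 14, 16, 1, 17],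
   [18, 16, 12, 14, 19, 15, 10, 11, 3, 7, 8, 6, 2, 4, 9, 5, 0, 1, 13, 17],
   [0, 1, 9, 5, 2, 4, 8, 6, 3, 7, 10, 11, 19, 15, 12, 14, 18, 16, 13, 17],
   [9, 13, 14, 12, 8, 10, 15, 11, 6, 7, 19, 3, 4, 2, 18, 0, 5, 1, 16, 17],
   [5, 1, 18, 0, 4, 2, 19, 3, 6, 7, 15, 11, 8, 10, 14, 12, 9, 13, 16, 17],
   [15, 19, 2, 3, 11, 7, 4, 6, 10, 8, 5, 9, 12, 13, 1, 17, 14, 16, 0, 18],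
   [14, 16, 1, 17, 12, 13, 5, 9, 10, 8, 4, 6, 11, 7, 2, 3, 15, 19, 0, 18],
   [3, 19, 14, 15, 7, 11, 12, 10, 6, 8, 13, 9, 4, 5, 17, 1, 2, 0, 16, 18],
   [2, 0, 17, 1, 4, 5, 13, 9, 6, 8, 12, 10, 7, 11, 14, 15, 3, 19, 16, 18],
   [17, 16, 15, 14, 13, 12, 11, 10, 9, 8, 7, 6, 5, 4, 3, 2, 1, 0, 19, 18],
   [1, 0, 3, 2, 5, 4, 7, 6, 9, 8, 11, 10, 13, 12, 15, 14, 17, 16, 19, 18],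
   [16, 18, 2, 0, 17, 1, 4, 5, 13, 9, 6, 8, 12, 10, 7, 11, 14, 15, 3, 19],
   [14, 15, 7, 11, 12, 10, 6, 8, 13, 9, 4, 5, 17, 1, 2, 0, 16, 18, 3, 19],
   [0, 18, 14, 16, 1, 17, 12, 13, 5, 9, 10, 8, 4, 6, 11, 7, 2, 3, 15, 19],
   [2, 3, 11, 7, 4, 6, 10, 8, 5, 9, 12, 13, 1, 17, 14, 16, 0, 18, 15, 19],
   [11, 15, 16, 14, 10, 12, 17, 13, 8, 9, 1, 5, 6, 4, 0, 2, 7, 3, 18, 19],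
   [7, 3, 0, 2, 6, 4, 1, 5, 8, 9, 17, 13, 10, 12, 16, 14, 11, 15, 18, 19]]

theorem L_eq : ext2 R = L := by decide +kernel

def app (l : List ℕ) (i : ℕ) : ℕ := l.getD (19 - i) 0

theorem chk2_map (f : ℕ → ℕ) (v : ℕ) (s : List ℕ)
    (h : ∀ u ∈ s, f v ≠ f u ∧ gA (f v) (f u) = gA v u) : chk2 v (f v) s (s.map f) = true := by
  induction s with
  | nil => rfl
  | cons u s ih =>
    have h1 := h u (by simp)
    have h2 := ih fun u hu => h u (by simp [hu])
    have h3 : Nat.beq (f v) (f u) = false := by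
      rw [Bool.eq_false_iff]; simpa [Nat.beq_eq] using h1.1
    simp [chk2, h2, h1.2, h3, agree_self]

theorem pre_map (f : ℕ → ℕ) (v : ℕ) (s : List ℕ)
    (h : ∀ u ∈ s, f v ≠ f u ∧ gA (f v) (f u) = gA v u) : pre v (f v) s (s.map f) = true := by
  rcases s with _ | ⟨a, _ | ⟨u, s⟩⟩
  · rfl
  · rfl
  · simp [pre, (h u (by simp)).2, agree_self]


theorem mem_ext2 (f : ℕ → ℕ) (s : List ℕ) (hs : s.Nodup) (hf : ∀ u ∈ s, f u < 20)
    (h : ∀ v ∈ s, ∀ u ∈ s, v ≠ u → f v ≠ f u ∧ gA (f v) (f u) = gA v u) :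
    s.map f ∈ ext2 s := by
  induction s with
  | nil => simp [ext2]
  | cons v s ih =>
    rw [ext2, List.mem_flatMap]
    rw [List.nodup_cons] at hs
    refine ⟨s.map f, ih hs.2 (fun u hu => hf u (by simp [hu]))
      (fun a ha b hb => h a (by simp [ha]) b (by simp [hb])), ?_⟩
    rw [List.mem_map]
    refine ⟨f v, List.mem_filter.2 ⟨by simpa using hf v (by simp), ?_⟩, rfl⟩
    rw [Bool.and_eq_true, and_comm]
    have : ∀ u ∈ s, f v ≠ f u ∧ gA (f v) (f u) = gA v u := by
      intro u hu
      exact h v (by simp) u (by simp [hu]) (by rintro rfl; exact hs.1 hu)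
    exact ⟨chk2_map f v s this, pre_map f v s this⟩

theorem L_all : L.length = 120 ∧ L.Nodup ∧ ∀ l ∈ L, l.Nodup ∧ l.length = 20 ∧
    (∀ x ∈ l, x < 20) ∧ ∀ e ∈ E, gA (app l e.1) (app l e.2) = true := by decide +kernel
theorem R_app : ∀ i < 20, R.getD (19 - i) 0 = i := by decide +kernel
theorem R_nodup : R.Nodup := by decide +kernel
theorem R_lt : ∀ u ∈ R, u < 20 := by decide +kernel

def pres (c c' : List (ℕ × ℕ)) (l : List ℕ) : Bool :=
  c.all fun e => cA c' (app l e.1) (app l e.2)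

theorem H_stab : ∀ c ∈ H, (L.filter (pres c c)).length = 4 := by decide +kernel
theorem H_trans : ∃ c₀ ∈ H, ∀ c ∈ H, ∃ l ∈ L, pres c₀ c l = true := by
  refine ⟨H.headD [], ?_, ?_⟩ <;> decide +kernel

def codeP (σ : Equiv.Perm W) : List ℕ := R.map fun i => ix (σ (vx i))

theorem app_codeP (σ : Equiv.Perm W) (v : W) : app (codeP σ) (ix v) = ix (σ v) := by
  have h : ∀ (f : ℕ → ℕ), ∀ i < 20, app (R.map f) i = f i := by
    intro f i hi
    interval_cases i <;> rfl
  rw [codeP, h _ _ (ix_lt v), vx_ix]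

theorem codeP_inj {σ τ : Equiv.Perm W} (h : codeP σ = codeP τ) : σ = τ := by
  ext1 v
  apply ix_inj
  rw [← app_codeP, ← app_codeP, h]

theorem codeP_mem {σ : Equiv.Perm W} (h : IsAut G σ) : codeP σ ∈ L := by
  rw [← L_eq]
  apply mem_ext2 _ _ R_nodup
  · intro u _; exact ix_lt _
  · intro v hv u hu hvu
    have hv := R_lt v hv
    have hu := R_lt u hu
    constructor
    · intro he
      have := congrArg ix (σ.injective (ix_inj he))
      rw [ix_vx v hv, ix_vx u hu] at this
      exact hvu this
    · rw [Bool.eq_iff_iff, ← G_adj, h, G_adj, ix_vx v hv, ix_vx u hu]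

theorem app_lt {l : List ℕ} (hl : l ∈ L) (i : ℕ) : app l i < 20 := by
  obtain ⟨-, h1, h2, -⟩ := L_all.2.2 l hl
  have : 19 - i < l.length := by omega
  rw [app, List.getD_eq_getElem _ _ this]
  exact h2 _ (List.getElem_mem _)

theorem app_inj {l : List ℕ} (hl : l ∈ L) {i j : ℕ} (hi : i < 20) (hj : j < 20)
    (h : app l i = app l j) : i = j := by
  obtain ⟨h0, h1, -, -⟩ := L_all.2.2 l hl
  have hi' : 19 - i < l.length := by omega
  have hj' : 19 - j < l.length := by omega
  rw [app, app, List.getD_eq_getElem _ _ hi', List.getD_eq_getElem _ _ hj',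
    h0.getElem_inj_iff] at h
  omega

theorem perm_inj {l : List ℕ} (hl : l ∈ L) : Function.Injective fun v : W => vx (app l (ix v)) := by
  intro v w h
  have := congrArg ix h
  simp only [ix_vx _ (app_lt hl _)] at this
  exact ix_inj (app_inj hl (ix_lt _) (ix_lt _) this)

noncomputable def perm {l : List ℕ} (hl : l ∈ L) : Equiv.Perm W :=
  Equiv.ofBijective _ (Finite.injective_iff_bijective.1 (perm_inj hl))

theorem perm_apply {l : List ℕ} (hl : l ∈ L) (v : W) : ix (perm hl v) = app l (ix v) := by
  change ix (vx (app l (ix v))) = _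
  rw [ix_vx _ (app_lt hl _)]

theorem codeP_perm {l : List ℕ} (hl : l ∈ L) : codeP (perm hl) = l := by
  obtain ⟨-, h1, -, -⟩ := L_all.2.2 l hl
  have hR : R.length = 20 := rfl
  apply List.ext_getElem
  · simp [codeP, hR, h1]
  · intro k h2 h3
    have hk : k < 20 := by omega
    have e1 := app_codeP (perm hl) (vx (19 - k))
    rw [perm_apply, ix_vx _ (by omega), app, app, List.getD_eq_getElem _ _ (by omega),
      List.getD_eq_getElem _ _ (by omega)] at e1
    have : 19 - (19 - k) = k := by omega
    simpa only [this] using e1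

theorem fwd_iff {C C' : SimpleGraph W} (σ : Equiv.Perm W)
    (h : ∀ u v, C.Adj u v → C'.Adj (σ u) (σ v)) (d : ℕ)
    (h1 : ∀ v, Nat.card {w // C.Adj v w} = d) (h2 : ∀ v, Nat.card {w // C'.Adj v w} = d) :
    ∀ u v, C'.Adj (σ u) (σ v) ↔ C.Adj u v := by
  classical
  intro u v
  refine ⟨fun huv => ?_, h u v⟩
  let g : {w // C.Adj u w} → {w // C'.Adj (σ u) w} := fun w => ⟨σ w.1, h _ _ w.2⟩
  have hg : Function.Injective g := by
    intro a b hab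
    exact Subtype.ext (σ.injective (congrArg Subtype.val hab))
  have hb := hg.bijective_of_nat_card_le (by rw [h1, h2])
  obtain ⟨w, hw⟩ := hb.2 ⟨σ v, huv⟩
  have : σ w.1 = σ v := congrArg Subtype.val hw
  rw [← σ.injective this]
  exact w.2

theorem G_deg (v : W) : Nat.card {w // G.Adj v w} = 3 := by
  have h := card_list (nb_nodup v)
  rw [nb, List.length_map, List.length_map, nb_len _ (ix_lt v)] at h
  rw [← h]
  exact Nat.card_congr (Equiv.subtypeEquivRight fun w => (mem_nb v w).symm)

theorem perm_aut {l : List ℕ} (hl : l ∈ L) : IsAut G (perm hl) := by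
  refine fwd_iff (C := G) (C' := G) _ ?_ 3 G_deg G_deg
  have hE := (L_all.2.2 l hl).2.2.2
  have key : ∀ u v, (ix u, ix v) ∈ E → G.Adj (perm hl u) (perm hl v) := by
    intro u v huv
    rw [G_adj, perm_apply, perm_apply]
    exact hE _ huv
  intro u v huv
  rw [G_adj', cA_iff] at huv
  rcases huv with h | h
  · exact key _ _ h
  · exact (key _ _ h).symm

theorem card_aut : autCard G = 120 := by
  rw [← L_all.1, ← card_list L_all.2.1, autCard]
  refine Nat.card_congr ⟨fun σ => ⟨codeP σ.1, codeP_mem σ.2⟩, fun l => ⟨perm l.2, perm_aut l.2⟩, ?_, ?_⟩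
  · intro σ; exact Subtype.ext (codeP_inj (codeP_perm (codeP_mem σ.2)))
  · intro l; exact Subtype.ext (codeP_perm l.2)

theorem pres_iff {C C' : SimpleGraph W} (hC : IsHamCycle G C) (hC' : IsHamCycle G C')
    (σ : Equiv.Perm W) : pres (code C) (code C') (codeP σ) = true ↔
      ∀ u v, C'.Adj (σ u) (σ v) ↔ C.Adj u v := by
  constructor
  · intro h
    refine fwd_iff σ ?_ 2 hC.2.2 hC'.2.2
    have key : ∀ u v, (ix u, ix v) ∈ code C → C'.Adj (σ u) (σ v) := by
      intro u v huv
      have := List.all_eq_true.1 h _ huv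
      rwa [app_codeP, app_codeP, ← C_adj hC'.1] at this
    intro u v huv
    rw [C_adj hC.1, cA_iff] at huv
    rcases huv with h | h
    · exact key _ _ h
    · exact (key _ _ h).symm
  · intro h
    rw [pres, List.all_eq_true]
    intro e he
    have hl := E_lt e (code_sub C e he)
    have h1 : C.Adj (vx e.1) (vx e.2) := by
      rw [C_adj hC.1, ix_vx _ hl.1, ix_vx _ hl.2, cA_iff]; exact Or.inl he
    have h2 := (h _ _).2 h1
    rwa [C_adj hC'.1, ← app_codeP, ← app_codeP, ix_vx _ hl.1, ix_vx _ hl.2] at h2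

theorem card_stab {C : SimpleGraph W} (hC : IsHamCycle G C) : autCapCard C G = 4 := by
  rw [← H_stab _ (code_mem_H hC), ← card_list (L_all.2.1.filter _), autCapCard]
  refine Nat.card_congr ⟨fun σ => ⟨codeP σ.1, List.mem_filter.2 ⟨codeP_mem σ.2.2,
      (pres_iff hC hC σ.1).2 σ.2.1⟩⟩,
    fun l => ⟨perm (List.mem_filter.1 l.2).1, (pres_iff hC hC _).1 ?_, perm_aut _⟩, ?_, ?_⟩
  · rw [codeP_perm]; exact (List.mem_filter.1 l.2).2
  · intro σ; exact Subtype.ext (codeP_inj (codeP_perm (codeP_mem σ.2.2)))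
  · intro l; exact Subtype.ext (codeP_perm (List.mem_filter.1 l.2).1)

theorem ham_iso {C C' : SimpleGraph W} (hC : IsHamCycle G C) (hC' : IsHamCycle G C') :
    Nonempty (C ≃g C') := by
  obtain ⟨c₀, h0, h⟩ := H_trans
  have key : ∀ D, IsHamCycle G D → Nonempty (gr c₀ ≃g D) := by
    intro D hD
    obtain ⟨l, hl, hp⟩ := h _ (code_mem_H hD)
    have := pres_iff (gr_ham h0) hD (perm hl)
    rw [code_gr h0, codeP_perm] at this
    exact ⟨⟨perm hl, fun {a b} => this.1 hp a b⟩⟩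
  obtain ⟨f⟩ := key C hC
  obtain ⟨g⟩ := key C' hC'
  exact ⟨f.symm.trans g⟩

theorem ham_of_iso {C C' : SimpleGraph W} (hC : IsHamCycle G C) (hC' : C' ≤ G)
    (f : C' ≃g C) : IsHamCycle G C' := by
  refine ⟨hC', f.connected_iff.2 hC.2.1, fun v => ?_⟩
  rw [← hC.2.2 (f v)]
  exact Nat.card_congr (f.toEquiv.subtypeEquiv fun w => (f.map_adj_iff).symm)

theorem card_s {C : SimpleGraph W} (hC : IsHamCycle G C) : sCard C G = 30 := by
  rw [← card_ham, sCard]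
  exact Nat.card_congr (Equiv.subtypeEquivRight fun D =>
    ⟨fun h => ham_of_iso hC h.1 h.2.some, fun h => ⟨h.1, ham_iso h hC⟩⟩)

theorem main : Nat.card {C : SimpleGraph W // IsHamCycle G C} = 30 ∧ autCard G = 120 ∧
    (∀ C, IsHamCycle G C → autCapCard C G = 4) ∧ InFHAM G := by
  refine ⟨card_ham, card_aut, fun C hC => card_stab hC, ?_, fun C hC => ⟨hC.1, ?_⟩⟩
  · obtain ⟨c, hc, -⟩ := H_trans
    exact ⟨_, gr_ham hc⟩
  · rw [card_s hC, card_aut, card_stab hC]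

end Dodec

/-- The dodecahedral graph `G(10,2)` has exactly 30 hamiltonian cycles, `|A(G)| = 120`,
`|A(C) ∩ A(G)| = 4` for every hamiltonian cycle `C`, and `G(10,2) ∈ F(HAM)`. -/
theorem dodecahedron_inFHAM :
    Nat.card {C : SimpleGraph (ZMod 10 ⊕ ZMod 10) // IsHamCycle (genPetersen 10 2) C} = 30 ∧
    autCard (genPetersen 10 2) = 120 ∧
    (∀ C, IsHamCycle (genPetersen 10 2) C → autCapCard C (genPetersen 10 2) = 4) ∧
    InFHAM (genPetersen 10 2) := by
  exact Dodec.main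
end
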